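/- Let $(M,g)$ be a $(2n+1)$-dimensional smooth Riemannian manifold with Levi-Civita connection $\nabla$, curvature tensor $R(X,Y)Z=\nabla_X\nabla_YZ-\nabla_Y\nabla_XZ-\nabla_{[X,Y]}Z$, Ricci tensor $S(Y,Z)=\operatorname{tr}(X\mapsto R(X,Y)Z)$ and Ricci operator $Q$, $g(QX,Y)=S(X,Y)$. Let $\varphi$ be a smooth $(1,1)$-tensor field, $\xi$ a smooth vector field and $\eta$ a smooth $1$-form on $M$ such that $(M,g,\varphi,\xi,\eta)$ is a Kenmotsu manifold, i.e. for all smooth vector fields $X,Y$, $$\varphi^2=-I+\eta\otimes\xi,\quad \eta(\xi)=1,\quad \eta(X)=g(X,\xi),\quad g(\varphi X,\varphi Y)=g(X,Y)-\eta(X)\eta(Y),$$ $$(\nabla_X\varphi)Y=g(\varphi X,Y)\xi-\eta(Y)\varphi X .$$ Let $V$ be a smooth vector field and let $\lambda,\mu,p$ be real constants such that $(g,V,\lambda,\mu)$ is a conformal $\eta$-Ricci soliton with conformal pressure $p$, i.e. $$\mathcal L_Vg+2S+\Big[2\lambda-\Big(p+\frac{2}{2n+1}\Big)\Big]g+2\mu\,\eta\otimes\eta=0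 .$$ Then, for all smooth vector fields $X,Y$, $$(\mathcal L_VR)(X,Y)\xi=2\big[(\nabla_XQ)Y-(\nabla_YQ)X+\eta(X)QY-\eta(Y)QX\big]+4n\big[\eta(X)Y-\eta(Y)X\big].$$ -/

import Mathlib

open Bundle VectorField FiberBundle
open scoped Manifold ContDiff

set_option linter.unusedSectionVars false

noncomputable section

namespace RiemannGeom

variable {E : Type*} [NormedAddCommGroup E] [NormedSpace ℝ E] [FiniteDimensional ℝ E]
  {H : Type*} [TopologicalSpace H] (I : ModelWithCorners ℝ E H)
  {M : Type*} [TopologicalSpace M] [ChartedSpace H M] [IsManifold I ∞ M]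
  [RiemannianBundle (fun x : M ↦ TangentSpace I x)]

instance finiteDimensional_tangentSpace (x : M) : FiniteDimensional ℝ (TangentSpace I x) :=
  inferInstanceAs (FiniteDimensional ℝ E)

/-- An orthonormal basis of `T_x M` for the Riemannian metric. -/
def frame (x : M) :
    OrthonormalBasis (Fin (Module.finrank ℝ (TangentSpace I x))) ℝ (TangentSpace I x) :=
  stdOrthonormalBasis ℝ (TangentSpace I x)

/-- Half of the Koszul expression:
`½ (X g(Y,Z) + Y g(Z,X) - Z g(X,Y) + g([X,Y],Z) - g([X,Z],Y) - g([Y,Z],X))`. -/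
def koszul (X Y Z : Π x : M, TangentSpace I x) (x : M) : ℝ :=
  (1 / 2 : ℝ) *
    (mvfderiv I (fun y ↦ inner ℝ (Y y) (Z y)) x (X x)
      + mvfderiv I (fun y ↦ inner ℝ (Z y) (X y)) x (Y x)
      - mvfderiv I (fun y ↦ inner ℝ (X y) (Y y)) x (Z x)
      + inner ℝ (mlieBracket I X Y x) (Z x)
      - inner ℝ (mlieBracket I X Z x) (Y x)
      - inner ℝ (mlieBracket I Y Z x) (X x))

variable [IsContMDiffRiemannianBundle I ∞ E (fun x : M ↦ TangentSpace I x)]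

variable {I}

theorem mdifferentiableAt_inner {X Y : Π x : M, TangentSpace I x} {x : M}
    (hX : MDiffAt (T% X) x) (hY : MDiffAt (T% Y) x) :
    MDiffAt (fun y ↦ inner ℝ (X y) (Y y)) x :=
  MDifferentiableAt.inner_bundle (E := fun x : M ↦ TangentSpace I x) (b := fun y : M ↦ y) hX hY

theorem mvfderiv_inner_smul_left {f : M → ℝ} {X Y : Π x : M, TangentSpace I x} {x : M}
    (hf : MDiffAt f x) (hX : MDiffAt (T% X) x) (hY : MDiffAt (T% Y) x) (u : TangentSpace I x) :
    mvfderiv I (fun y ↦ inner ℝ ((f • X) y) (Y y)) x u =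
      f x * mvfderiv I (fun y ↦ inner ℝ (X y) (Y y)) x u
        + mvfderiv I f x u * inner ℝ (X x) (Y x) := by
  have h := mvfderiv_fun_mul hf (mdifferentiableAt_inner hX hY)
  have e : (fun y ↦ inner ℝ ((f • X) y) (Y y)) = fun y ↦ f y * inner ℝ (X y) (Y y) := by
    funext y
    simp [inner_smul_left]
  rw [e, h]
  simp
  ring

theorem mvfderiv_inner_add_left {X X' Y : Π x : M, TangentSpace I x} {x : M}
    (hX : MDiffAt (T% X) x) (hX' : MDiffAt (T% X') x) (hY : MDiffAt (T% Y) x)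
    (u : TangentSpace I x) :
    mvfderiv I (fun y ↦ inner ℝ ((X + X') y) (Y y)) x u =
      mvfderiv I (fun y ↦ inner ℝ (X y) (Y y)) x u
        + mvfderiv I (fun y ↦ inner ℝ (X' y) (Y y)) x u := by
  have h := mvfderiv_fun_add (mdifferentiableAt_inner hX hY) (mdifferentiableAt_inner hX' hY)
  have e : (fun y ↦ inner ℝ ((X + X') y) (Y y)) =
      fun y ↦ inner ℝ (X y) (Y y) + inner ℝ (X' y) (Y y) := by
    funext y
    simp [inner_add_left]
  rw [e, h]
  simp

theorem mvfderiv_inner_comm (X Y : Π x : M, TangentSpace I x) :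
    mvfderiv I (fun y ↦ inner ℝ (X y) (Y y)) = mvfderiv I (fun y ↦ inner ℝ (Y y) (X y)) := by
  congr 1
  funext y
  exact real_inner_comm _ _

theorem koszul_tensorial_left {Y Z : Π x : M, TangentSpace I x} {x : M}
    (hY : MDiffAt (T% Y) x) (hZ : MDiffAt (T% Z) x) :
    TensorialAt I E (fun X ↦ koszul I X Y Z x) x where
  smul {f X} hf hX := by
    simp only [koszul]
    rw [mvfderiv_inner_comm Z (f • X), mvfderiv_inner_comm Z X,
      mvfderiv_inner_smul_left hf hX hY, mvfderiv_inner_smul_left hf hX hZ,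
      mlieBracket_smul_left hf hX, mlieBracket_smul_left hf hX]
    simp [inner_add_left, inner_smul_left, inner_smul_right]
    ring
  add {X X'} hX hX' := by
    simp only [koszul]
    rw [mvfderiv_inner_comm Z (X + X'), mvfderiv_inner_comm Z X, mvfderiv_inner_comm Z X',
      mvfderiv_inner_add_left hX hX' hY, mvfderiv_inner_add_left hX hX' hZ,
      mlieBracket_add_left hX hX', mlieBracket_add_left hX hX']
    simp [inner_add_left, inner_add_right]
    ring

theorem koszul_tensorial_right {X Y : Π x : M, TangentSpace I x} {x : M}
    (hX : MDiffAt (T% X) x) (hY : MDiffAt (T% Y) x) :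
    TensorialAt I E (fun Z ↦ koszul I X Y Z x) x where
  smul {f Z} hf hZ := by
    simp only [koszul]
    rw [mvfderiv_inner_comm Y (f • Z), mvfderiv_inner_comm Y Z,
      mvfderiv_inner_smul_left hf hZ hX, mvfderiv_inner_smul_left hf hZ hY,
      mlieBracket_smul_right hf hZ, mlieBracket_smul_right hf hZ]
    simp [inner_add_left, inner_smul_left, inner_smul_right, real_inner_comm]
    ring
  add {Z Z'} hZ hZ' := by
    simp only [koszul]
    rw [mvfderiv_inner_comm Y (Z + Z'), mvfderiv_inner_comm Y Z, mvfderiv_inner_comm Y Z',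
      mvfderiv_inner_add_left hZ hZ' hX, mvfderiv_inner_add_left hZ hZ' hY,
      mlieBracket_add_right hZ hZ', mlieBracket_add_right hZ hZ']
    simp [inner_add_left, inner_add_right]
    ring

theorem koszul_smul {f : M → ℝ} {X Y Z : Π x : M, TangentSpace I x} {x : M}
    (hf : MDiffAt f x) (hX : MDiffAt (T% X) x) (hY : MDiffAt (T% Y) x) (hZ : MDiffAt (T% Z) x) :
    koszul I X (f • Y) Z x =
      f x * koszul I X Y Z x + mvfderiv I f x (X x) * inner ℝ (Y x) (Z x) := by
  simp only [koszul]
  rw [mvfderiv_inner_comm X (f • Y), mvfderiv_inner_comm X Y,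
    mvfderiv_inner_smul_left hf hY hX, mvfderiv_inner_smul_left hf hY hZ,
    mlieBracket_smul_right hf hY, mlieBracket_smul_left hf hY]
  simp [inner_add_left, inner_smul_left, inner_smul_right, real_inner_comm]
  ring

theorem koszul_add {X Y Y' Z : Π x : M, TangentSpace I x} {x : M}
    (hX : MDiffAt (T% X) x) (hY : MDiffAt (T% Y) x) (hY' : MDiffAt (T% Y') x)
    (hZ : MDiffAt (T% Z) x) :
    koszul I X (Y + Y') Z x = koszul I X Y Z x + koszul I X Y' Z x := by
  simp only [koszul]
  rw [mvfderiv_inner_comm X (Y + Y'), mvfderiv_inner_comm X Y, mvfderiv_inner_comm X Y',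
    mvfderiv_inner_add_left hY hY' hX, mvfderiv_inner_add_left hY hY' hZ,
    mlieBracket_add_right hY hY', mlieBracket_add_left hY hY']
  simp [inner_add_left, inner_add_right]
  ring

/-- For `Y` differentiable at `x`, the bilinear form `(u, w) ↦ g(∇_u Y, w)` on `T_x M` given by
the Koszul formula. -/
def koszulForm {Y : Π x : M, TangentSpace I x} {x : M} (hY : MDiffAt (T% Y) x) :
    TangentSpace I x →L[ℝ] TangentSpace I x →L[ℝ] ℝ :=
  TensorialAt.mkHom₂ (I := I) (F := E) (F' := E) (fun X Z ↦ koszul I X Y Z x) x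
    (fun _ hZ ↦ koszul_tensorial_left hY hZ) (fun _ hX ↦ koszul_tensorial_right hX hY)

theorem koszulForm_apply {X Y Z : Π x : M, TangentSpace I x} {x : M}
    (hX : MDiffAt (T% X) x) (hY : MDiffAt (T% Y) x) (hZ : MDiffAt (T% Z) x) :
    koszulForm hY (X x) (Z x) = koszul I X Y Z x :=
  TensorialAt.mkHom₂_apply (I := I) (F := E) (F' := E)
    (fun _ hZ ↦ koszul_tensorial_left hY hZ) (fun _ hX ↦ koszul_tensorial_right hX hY) hX hZ

theorem koszulForm_add {Y Y' : Π x : M, TangentSpace I x} {x : M}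
    (hY : MDiffAt (T% Y) x) (hY' : MDiffAt (T% Y') x) (h : MDiffAt (T% (Y + Y')) x) :
    koszulForm h = koszulForm hY + koszulForm hY' := by
  ext u w
  exact koszul_add (mdifferentiableAt_extend I E u) hY hY' (mdifferentiableAt_extend I E w)

theorem koszulForm_smul {f : M → ℝ} {Y : Π x : M, TangentSpace I x} {x : M}
    (hf : MDiffAt f x) (hY : MDiffAt (T% Y) x) (h : MDiffAt (T% (f • Y)) x)
    (u w : TangentSpace I x) :
    koszulForm h u w = f x * koszulForm hY u w + mvfderiv I f x u * inner ℝ (Y x) w := by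
  have := koszul_smul hf (mdifferentiableAt_extend I E u) hY (mdifferentiableAt_extend I E w)
  rw [extend_apply_self, extend_apply_self] at this
  exact this

open Classical in
/-- The vector-valued form `u ↦ ∇_u Y` at `x`: the vector `∇_u Y` is the one whose inner product
with every `w` is given by the Koszul formula, `∇_u Y = ∑ᵢ g(∇_u Y, eᵢ) eᵢ`. (It is set to `0` where
`Y` is not differentiable.) -/
def leviCivitaAux (Y : Π x : M, TangentSpace I x) (x : M) :
    TangentSpace I x →L[ℝ] TangentSpace I x :=
  if hY : MDiffAt (T% Y) x then
    ∑ i, ((koszulForm hY).flip (frame I x i)).smulRight (frame I x i)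
  else 0

theorem inner_leviCivitaAux {Y : Π x : M, TangentSpace I x} {x : M} (hY : MDiffAt (T% Y) x)
    (u w : TangentSpace I x) : inner ℝ (leviCivitaAux Y x u) w = koszulForm hY u w := by
  rw [leviCivitaAux, dif_pos hY]
  conv_rhs => rw [← (frame I x).sum_repr' w]
  simp [sum_inner, inner_smul_left, mul_comm]

variable (I M) in
/-- The Levi-Civita connection of the Riemannian manifold `M`; `leviCivita I M Y x u` is
`(∇_u Y)(x)`. -/
def leviCivita : CovariantDerivative I E (fun x : M ↦ TangentSpace I x) where
  toFun := leviCivitaAux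
  isCovariantDerivativeOnUniv :=
    { add := by
        intro Y Y' x hY hY' _
        ext u
        refine ext_inner_right ℝ fun w ↦ ?_
        have h : MDiffAt (T% (Y + Y')) x := mdifferentiableAt_add_section hY hY'
        rw [inner_leviCivitaAux h, koszulForm_add hY hY']
        simp [inner_add_left, inner_leviCivitaAux hY, inner_leviCivitaAux hY']
      leibniz := by
        intro Y f x hY hf _
        ext u
        refine ext_inner_right ℝ fun w ↦ ?_
        have h : MDiffAt (T% (f • Y)) x := hf.smul_section hY
        rw [inner_leviCivitaAux h, koszulForm_smul hf hY]
        simp [inner_add_left, inner_smul_left, inner_leviCivitaAux hY] }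

theorem inner_leviCivita {X Y Z : Π x : M, TangentSpace I x} {x : M}
    (hX : MDiffAt (T% X) x) (hY : MDiffAt (T% Y) x) (hZ : MDiffAt (T% Z) x) :
    inner ℝ (leviCivita I M Y x (X x)) (Z x) = koszul I X Y Z x := by
  rw [← koszulForm_apply hX hY hZ]
  exact inner_leviCivitaAux hY _ _

/-- The Levi-Civita connection is torsion free. -/
theorem leviCivita_torsion_eq_zero : (leviCivita I M).torsion = 0 := by
  rw [CovariantDerivative.torsion_eq_zero_iff]
  intro X Y x hX hY
  refine ext_inner_right ℝ fun w ↦ ?_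
  have hw := mdifferentiableAt_extend I E w
  have h1 := inner_leviCivita hX hY hw
  have h2 := inner_leviCivita hY hX hw
  rw [extend_apply_self] at h1 h2
  rw [inner_sub_left, h1, h2]
  simp only [koszul]
  rw [mvfderiv_inner_comm (extend E w) X, mvfderiv_inner_comm (extend E w) Y,
    mvfderiv_inner_comm Y X, mlieBracket_swap_apply (V := Y) (W := X)]
  simp [inner_neg_left]
  ring

/-- The Levi-Civita connection is compatible with the metric. -/
theorem leviCivita_metric {X Y Z : Π x : M, TangentSpace I x} {x : M}
    (hX : MDiffAt (T% X) x) (hY : MDiffAt (T% Y) x) (hZ : MDiffAt (T% Z) x) :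
    mvfderiv I (fun y ↦ inner ℝ (Y y) (Z y)) x (X x) =
      inner ℝ (leviCivita I M Y x (X x)) (Z x) + inner ℝ (Y x) (leviCivita I M Z x (X x)) := by
  rw [real_inner_comm _ (Y x), inner_leviCivita hX hY hZ, inner_leviCivita hX hZ hY]
  simp only [koszul]
  rw [mvfderiv_inner_comm Z Y, mvfderiv_inner_comm Z X, mvfderiv_inner_comm Y X,
    mlieBracket_swap_apply (V := Z) (W := Y)]
  simp [inner_neg_left]
  ring

variable (I)

/-- `∇_X Y` for the Levi-Civita connection. -/
def nabla (X Y : Π x : M, TangentSpace I x) : Π x : M, TangentSpace I x :=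
  fun x ↦ leviCivita I M Y x (X x)

/-- The curvature tensor `R(X,Y)Z = ∇_X ∇_Y Z - ∇_Y ∇_X Z - ∇_[X,Y] Z`. -/
def curvature (X Y Z : Π x : M, TangentSpace I x) : Π x : M, TangentSpace I x :=
  nabla I X (nabla I Y Z) - nabla I Y (nabla I X Z) - nabla I (mlieBracket I X Y) Z

/-- The Ricci tensor `S(Y,Z) = trace (X ↦ R(X,Y)Z) = ∑ᵢ g(R(eᵢ,Y)Z, eᵢ)`. At the point `x`, the
orthonormal basis of `T_x M` is extended to vector fields that are smooth near `x`. -/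
def ricci (Y Z : Π x : M, TangentSpace I x) (x : M) : ℝ :=
  ∑ i, inner ℝ (curvature I (extend E (frame I x i)) Y Z x) (frame I x i)

/-- The Ricci operator `QY = ∑ⱼ S(Y,eⱼ) eⱼ`, i.e. `g(QY,Z) = S(Y,Z)`. -/
def ricciOp (Y : Π x : M, TangentSpace I x) : Π x : M, TangentSpace I x :=
  fun x ↦ ∑ j, ricci I Y (extend E (frame I x j)) x • frame I x j

/-- The covariant derivative of the Ricci operator, `(∇_X Q)Y = ∇_X (QY) - Q(∇_X Y)`. -/
def nablaRicciOp (X Y : Π x : M, TangentSpace I x) : Π x : M, TangentSpace I x :=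
  nabla I X (ricciOp I Y) - ricciOp I (nabla I X Y)

/-- The Lie derivative of the metric, `(L_V g)(X,Y) = V g(X,Y) - g([V,X],Y) - g(X,[V,Y])`. -/
def lieMetric (V X Y : Π x : M, TangentSpace I x) (x : M) : ℝ :=
  mvfderiv I (fun y ↦ inner ℝ (X y) (Y y)) x (V x)
    - inner ℝ (mlieBracket I V X x) (Y x) - inner ℝ (X x) (mlieBracket I V Y x)

/-- The Lie derivative of the curvature tensor,
`(L_V R)(X,Y)Z = [V, R(X,Y)Z] - R([V,X],Y)Z - R(X,[V,Y])Z - R(X,Y)[V,Z]`. -/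
def lieCurvature (V X Y Z : Π x : M, TangentSpace I x) : Π x : M, TangentSpace I x :=
  mlieBracket I V (curvature I X Y Z) - curvature I (mlieBracket I V X) Y Z
    - curvature I X (mlieBracket I V Y) Z - curvature I X Y (mlieBracket I V Z)

/-- `(φ, ξ, η)` is, together with the Riemannian metric of `M`, an almost contact metric
structure. -/
structure IsAlmostContactMetric (φ : Π x : M, TangentSpace I x →L[ℝ] TangentSpace I x)
    (ξ : Π x : M, TangentSpace I x) (η : Π x : M, TangentSpace I x →L[ℝ] ℝ) : Prop where
  contMDiff_phi : ContMDiff I (I.prod 𝓘(ℝ, E →L[ℝ] E)) ∞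
    (fun x ↦ TotalSpace.mk' (E →L[ℝ] E) (E := fun x : M ↦ TangentSpace I x →L[ℝ] TangentSpace I x)
      x (φ x))
  contMDiff_xi : CMDiff ∞ (T% ξ)
  contMDiff_eta : ContMDiff I (I.prod 𝓘(ℝ, E →L[ℝ] ℝ)) ∞
    (fun x ↦ TotalSpace.mk' (E →L[ℝ] ℝ)
      (E := fun x : M ↦ TangentSpace I x →L[ℝ] Bundle.Trivial M ℝ x) x (η x))
  phi_sq : ∀ (x : M) (u : TangentSpace I x), φ x (φ x u) = -u + η x u • ξ x
  eta_xi : ∀ x : M, η x (ξ x) = 1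
  eta_eq : ∀ (x : M) (u : TangentSpace I x), η x u = inner ℝ u (ξ x)
  inner_phi : ∀ (x : M) (u v : TangentSpace I x),
    inner ℝ (φ x u) (φ x v) = inner ℝ u v - η x u * η x v

/-- `(M, g, φ, ξ, η)` is a Kenmotsu manifold: an almost contact metric manifold with
`(∇_X φ)Y = ∇_X (φY) - φ(∇_X Y) = g(φX,Y)ξ - η(Y)φX` for all smooth vector fields `X`, `Y`. -/
structure IsKenmotsu (φ : Π x : M, TangentSpace I x →L[ℝ] TangentSpace I x)
    (ξ : Π x : M, TangentSpace I x) (η : Π x : M, TangentSpace I x →L[ℝ] ℝ) : Prop extends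
    IsAlmostContactMetric I φ ξ η where
  nabla_phi : ∀ X Y : Π x : M, TangentSpace I x, CMDiff ∞ (T% X) → CMDiff ∞ (T% Y) → ∀ x : M,
    nabla I X (fun y ↦ φ y (Y y)) x - φ x (nabla I X Y x) =
      (inner ℝ (φ x (X x)) (Y x) : ℝ) • ξ x - η x (Y x) • φ x (X x)

/-- `(g, V, lam, mu)` is a conformal `η`-Ricci soliton with conformal pressure `p`:
`L_V g + 2S + [2 lam - (p + 2 / dim M)] g + 2 mu η ⊗ η = 0`. -/
structure IsConformalEtaRicciSoliton (η : Π x : M, TangentSpace I x →L[ℝ] ℝ)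
    (V : Π x : M, TangentSpace I x) (lam mu p : ℝ) : Prop where
  contMDiff_V : CMDiff ∞ (T% V)
  soliton_eq : ∀ X Y : Π x : M, TangentSpace I x, CMDiff ∞ (T% X) → CMDiff ∞ (T% Y) → ∀ x : M,
    lieMetric I V X Y x + 2 * ricci I X Y x
      + (2 * lam - (p + 2 / (Module.finrank ℝ E : ℝ))) * inner ℝ (X x) (Y x)
      + 2 * mu * (η x (X x) * η x (Y x)) = 0

end RiemannGeom

end

namespace RiemannGeom

open Topology

noncomputable section

variable {E : Type*} [NormedAddCommGroup E] [NormedSpace ℝ E] [FiniteDimensional ℝ E]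
  {M : Type*} [TopologicalSpace M] [ChartedSpace E M] [IsManifold 𝓘(ℝ, E) ∞ M]

variable (E M) in
/-- Smooth vector fields on `M`. -/
abbrev SmoothField : Type _ :=
  Cₛ^∞⟮𝓘(ℝ, E); E, (fun x : M ↦ TangentSpace 𝓘(ℝ, E) x)⟯

variable (E M) in
/-- Smooth real functions on `M`. -/
abbrev SmoothFun : Type _ := C^∞⟮𝓘(ℝ, E), M; 𝓘(ℝ), ℝ⟯

instance : SMul (SmoothFun E M) (SmoothField E M) :=
  ⟨fun f X ↦ ⟨(f : M → ℝ) • (X : Π x : M, TangentSpace 𝓘(ℝ, E) x),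
    f.contMDiff.smul_section X.contMDiff⟩⟩

@[simp] theorem smul_field_apply (f : SmoothFun E M) (X : SmoothField E M) (x : M) :
    (f • X) x = f x • X x := rfl

theorem coe_smul_field (f : SmoothFun E M) (X : SmoothField E M) :
    ⇑(f • X) = (f : M → ℝ) • (X : Π x : M, TangentSpace 𝓘(ℝ, E) x) := rfl

@[simp] theorem add_field_apply (X Y : SmoothField E M) (x : M) : (X + Y) x = X x + Y x := rfl
@[simp] theorem sub_field_apply (X Y : SmoothField E M) (x : M) : (X - Y) x = X x - Y x := rfl
@[simp] theorem zero_field_apply (x : M) : (0 : SmoothField E M) x = 0 := rfl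

@[simp] theorem sum_field_apply {ι : Type*} (s : Finset ι) (X : ι → SmoothField E M) (x : M) :
    (∑ i ∈ s, X i) x = ∑ i ∈ s, X i x := by
  classical
  induction s using Finset.induction_on with
  | empty => simp
  | insert a s ha h => simp [Finset.sum_insert ha, h]

@[simp] theorem sum_fun_apply {ι : Type*} (s : Finset ι) (f : ι → SmoothFun E M) (x : M) :
    (∑ i ∈ s, f i) x = ∑ i ∈ s, f i x := by
  classical
  induction s using Finset.induction_on with
  | empty => simp
  | insert a s ha h => simp [Finset.sum_insert ha, h]

instance : Module (SmoothFun E M) (SmoothField E M) where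
  one_smul X := by ext x; simp
  mul_smul f h X := by ext x; simp [mul_smul]
  smul_zero f := by ext x; simp
  smul_add f X Y := by ext x; simp
  add_smul f h X := by ext x; simp [add_smul]
  zero_smul X := by ext x; simp

theorem mdiffAt_field (X : SmoothField E M) (x : M) :
    MDiffAt (T% (X : Π x, TangentSpace 𝓘(ℝ, E) x)) x :=
  X.mdifferentiableAt

theorem mdiffAt_fun (f : SmoothFun E M) (x : M) : MDiffAt (f : M → ℝ) x :=
  (f.contMDiff x).mdifferentiableAt (by simp)

section Cutoff

variable [T2Space M]

/-- A smooth function that is `1` near `x` and supported in a given neighbourhood of `x`. -/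
theorem exists_smoothFun_eventuallyEq_one {x : M} {u : Set M} (hu : u ∈ 𝓝 x) :
    ∃ ψ : SmoothFun E M, (∀ᶠ y in 𝓝 x, ψ y = 1) ∧ tsupport ψ ⊆ u := by
  obtain ⟨f, hf, -⟩ := (SmoothBumpFunction.nhds_basis_support (I := 𝓘(ℝ, E)) hu).mem_iff.1 hu
  exact ⟨⟨f, f.contMDiff⟩, f.eventuallyEq_one, hf⟩

/-- A vector field that is smooth near `x` agrees near `x` with a smooth vector field. -/
theorem exists_smoothField_eventuallyEq {W : Π x : M, TangentSpace 𝓘(ℝ, E) x} {x : M} {u : Set M}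
    (hu : u ∈ 𝓝 x) (hW : CMDiff[u] ∞ (T% W)) :
    ∃ W' : SmoothField E M, ∀ᶠ y in 𝓝 x, W' y = W y := by
  obtain ⟨v, hvu, hv, hxv⟩ := mem_nhds_iff.1 hu
  obtain ⟨ψ, hψ, hs⟩ := exists_smoothFun_eventuallyEq_one (E := E) (hv.mem_nhds hxv)
  refine ⟨⟨(ψ : M → ℝ) • W,
    ContMDiffOn.smul_section_of_tsupport ψ.contMDiff.contMDiffOn hv hs (hW.mono hvu)⟩, ?_⟩
  filter_upwards [hψ] with y hy
  change ψ y • W y = W y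
  rw [hy, one_smul]

theorem exists_smoothField_eventuallyEq_extend {x : M} (v : TangentSpace 𝓘(ℝ, E) x) :
    ∃ X : SmoothField E M, X x = v ∧ ∀ᶠ y in 𝓝 x, X y = extend E v y := by
  obtain ⟨u, hu, h⟩ := exists_contMDiffOn_extend (k := ∞) 𝓘(ℝ, E) E v
  obtain ⟨X, hX⟩ := exists_smoothField_eventuallyEq hu h
  exact ⟨X, by rw [hX.self_of_nhds, extend_apply_self], hX⟩

theorem exists_smoothField_apply_eq {x : M} (v : TangentSpace 𝓘(ℝ, E) x) :
    ∃ X : SmoothField E M, X x = v :=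
  let ⟨X, h, _⟩ := exists_smoothField_eventuallyEq_extend v
  ⟨X, h⟩

end Cutoff

section Frames

variable [RiemannianBundle (fun x : M ↦ TangentSpace 𝓘(ℝ, E) x)]
  [IsContMDiffRiemannianBundle 𝓘(ℝ, E) ∞ E (fun x : M ↦ TangentSpace 𝓘(ℝ, E) x)]

theorem contMDiffAt_field_of_eq {W W' : Π x : M, TangentSpace 𝓘(ℝ, E) x} {x : M} (h : W = W')
    (hW' : CMDiffAt ∞ (T% W') x) : CMDiffAt ∞ (T% W) x :=
  h ▸ hW'

theorem contMDiffAt_inner {X Y : Π x : M, TangentSpace 𝓘(ℝ, E) x} {x : M}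
    (hX : CMDiffAt ∞ (T% X) x) (hY : CMDiffAt ∞ (T% Y) x) :
    CMDiffAt ∞ (fun y ↦ (inner ℝ (X y) (Y y) : ℝ)) x :=
  ContMDiffAt.inner_bundle (E := fun x : M ↦ TangentSpace 𝓘(ℝ, E) x) (b := fun y : M ↦ y) hX hY

/-- The metric as a smooth function. -/
def metric (X Y : SmoothField E M) : SmoothFun E M :=
  ⟨fun x ↦ inner ℝ (X x) (Y x), fun x ↦ contMDiffAt_inner (X.contMDiff x) (Y.contMDiff x)⟩

@[simp] theorem metric_apply (X Y : SmoothField E M) (x : M) :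
    metric X Y x = inner ℝ (X x) (Y x) := rfl

theorem contMDiffAt_gramSchmidt {ι : Type*} [LinearOrder ι] [LocallyFiniteOrderBot ι]
    [WellFoundedLT ι] {s : ι → Π x : M, TangentSpace 𝓘(ℝ, E) x} {x : M}
    (hs : ∀ i, CMDiffAt ∞ (T% (s i)) x) (hli : LinearIndependent ℝ (fun i ↦ s i x)) (i : ι) :
    CMDiffAt ∞ (T% (fun y ↦ InnerProductSpace.gramSchmidt ℝ (fun j ↦ s j y) i)) x := by
  induction i using WellFoundedLT.induction with
  | ind i ih =>
    have e : (fun y : M ↦ InnerProductSpace.gramSchmidt ℝ (fun j ↦ s j y) i) =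
        s i - fun y ↦ ∑ j ∈ Finset.Iio i,
          ((fun y ↦ ((inner ℝ (InnerProductSpace.gramSchmidt ℝ (fun j ↦ s j y) j) (s i y) : ℝ) /
            (inner ℝ (InnerProductSpace.gramSchmidt ℝ (fun j ↦ s j y) j)
              (InnerProductSpace.gramSchmidt ℝ (fun j ↦ s j y) j) : ℝ))) •
            fun y ↦ InnerProductSpace.gramSchmidt ℝ (fun j ↦ s j y) j) y := by
      funext y
      rw [InnerProductSpace.gramSchmidt_def]
      simp [Submodule.starProjection_singleton]
    refine contMDiffAt_field_of_eq e ?_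
    refine (hs i).sub_section (ContMDiffAt.sum_section fun j hj ↦ ?_)
    have hj' := ih j (Finset.mem_Iio.1 hj)
    refine ContMDiffAt.smul_section ?_ hj'
    refine (contMDiffAt_inner hj' (hs i)).div₀ (contMDiffAt_inner hj' hj') ?_
    exact inner_self_ne_zero.2 (InnerProductSpace.gramSchmidt_ne_zero j hli)

theorem contMDiffAt_gramSchmidtNormed {ι : Type*} [LinearOrder ι] [LocallyFiniteOrderBot ι]
    [WellFoundedLT ι] {s : ι → Π x : M, TangentSpace 𝓘(ℝ, E) x} {x : M}
    (hs : ∀ i, CMDiffAt ∞ (T% (s i)) x) (hli : LinearIndependent ℝ (fun i ↦ s i x)) (i : ι) :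
    CMDiffAt ∞ (T% (fun y ↦ InnerProductSpace.gramSchmidtNormed ℝ (fun j ↦ s j y) i)) x := by
  have h := contMDiffAt_gramSchmidt hs hli i
  have h0 := inner_self_ne_zero (𝕜 := ℝ).2 (InnerProductSpace.gramSchmidt_ne_zero i hli)
  have e : (fun y : M ↦ InnerProductSpace.gramSchmidtNormed ℝ (fun j ↦ s j y) i) =
      (fun y ↦ (Real.sqrt (inner ℝ (InnerProductSpace.gramSchmidt ℝ (fun j ↦ s j y) i)
        (InnerProductSpace.gramSchmidt ℝ (fun j ↦ s j y) i)))⁻¹) •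
        fun y ↦ InnerProductSpace.gramSchmidt ℝ (fun j ↦ s j y) i := by
    funext y
    simp [InnerProductSpace.gramSchmidtNormed]
  refine contMDiffAt_field_of_eq e ?_
  refine ContMDiffAt.smul_section ?_ h
  refine ContMDiffAt.inv₀ ?_ ?_
  · exact (Real.contDiffAt_sqrt h0).contMDiffAt.comp x (contMDiffAt_inner h h)
  · exact (Real.sqrt_pos.2 (lt_of_le_of_ne real_inner_self_nonneg h0.symm)).ne'

/-- A family of vector fields that is an orthonormal basis of the tangent space at every point
near `x`. -/
def IsOrthonormalFrameAt {ι : Type*} [Fintype ι] (e : ι → SmoothField E M) (x : M) : Prop :=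
  ∀ᶠ y in 𝓝 x, ∃ b : OrthonormalBasis ι ℝ (TangentSpace 𝓘(ℝ, E) y), ∀ i, b i = e i y

theorem exists_isOrthonormalFrameAt [T2Space M] (x : M) :
    ∃ e : Fin (Module.finrank ℝ E) → SmoothField E M, IsOrthonormalFrameAt e x := by
  let t := trivializationAt E (fun x : M ↦ TangentSpace 𝓘(ℝ, E) x) x
  have hx : x ∈ t.baseSet := FiberBundle.mem_baseSet_trivializationAt' x
  let b := Module.finBasis ℝ E
  let s := t.localFrame b
  have hs := Bundle.Trivialization.isLocalFrameOn_localFrame_baseSet 𝓘(ℝ, E) ∞ t b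
  have hsm (i) {y} (hy : y ∈ t.baseSet) : CMDiffAt ∞ (T% (s i)) y :=
    contMDiffAt_localFrame_of_mem ∞ t b i hy
  have hN (i) : CMDiff[t.baseSet] ∞
      (T% (fun y ↦ InnerProductSpace.gramSchmidtNormed ℝ (fun j ↦ s j y) i)) := fun y hy ↦
    (contMDiffAt_gramSchmidtNormed (fun j ↦ hsm j hy) (hs.linearIndependent hy) i).contMDiffWithinAt
  have hmem := t.open_baseSet.mem_nhds hx
  choose e he using fun i ↦ exists_smoothField_eventuallyEq hmem (hN i)
  refine ⟨e, ?_⟩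
  filter_upwards [Filter.eventually_all.2 he, hmem] with y hy hyt
  have hli : LinearIndependent ℝ (fun j ↦ s j y) := hs.linearIndependent hyt
  have hcard : Module.finrank ℝ (TangentSpace 𝓘(ℝ, E) y) =
      Fintype.card (Fin (Module.finrank ℝ E)) := by
    rw [Fintype.card_fin]; rfl
  refine ⟨InnerProductSpace.gramSchmidtOrthonormalBasis hcard (fun j ↦ s j y), fun i ↦ ?_⟩
  rw [InnerProductSpace.gramSchmidtOrthonormalBasis_apply, hy i]
  have := InnerProductSpace.gramSchmidtNormed_unit_length i hli
  intro h
  rw [h, norm_zero] at this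
  exact zero_ne_one this

end Frames

theorem IsOrthonormalFrameAt.eventually_nhds
    [RiemannianBundle (fun x : M ↦ TangentSpace 𝓘(ℝ, E) x)] {ι : Type*} [Fintype ι]
    {e : ι → SmoothField E M} {x : M} (he : IsOrthonormalFrameAt e x) :
    ∀ᶠ y in 𝓝 x, IsOrthonormalFrameAt e y :=
  eventually_eventually_nhds.2 he

theorem IsOrthonormalFrameAt.sum_inner_smul
    [RiemannianBundle (fun x : M ↦ TangentSpace 𝓘(ℝ, E) x)] {ι : Type*} [Fintype ι]
    {e : ι → SmoothField E M} {x : M} (he : IsOrthonormalFrameAt e x)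
    (v : TangentSpace 𝓘(ℝ, E) x) : ∑ i, (inner ℝ v (e i x) : ℝ) • e i x = v := by
  obtain ⟨b, hb⟩ := he.self_of_nhds
  simpa [hb, real_inner_comm] using b.sum_repr' v

theorem IsOrthonormalFrameAt.sum_inner_mul_inner
    [RiemannianBundle (fun x : M ↦ TangentSpace 𝓘(ℝ, E) x)] {ι : Type*} [Fintype ι]
    {e : ι → SmoothField E M} {x : M} (he : IsOrthonormalFrameAt e x)
    (v w : TangentSpace 𝓘(ℝ, E) x) :
    ∑ i, (inner ℝ v (e i x) : ℝ) * inner ℝ w (e i x) = inner ℝ v w := by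
  conv_rhs => rw [← he.sum_inner_smul v]
  simp [sum_inner, inner_smul_left, real_inner_comm]

theorem IsOrthonormalFrameAt.inner_eq  [RiemannianBundle (fun x : M ↦ TangentSpace 𝓘(ℝ, E) x)]
    {ι : Type*} [Fintype ι] [DecidableEq ι]
    {e : ι → SmoothField E M} {x : M} (he : IsOrthonormalFrameAt e x) (i j : ι) :
    (inner ℝ (e i x) (e j x) : ℝ) = if i = j then 1 else 0 := by
  obtain ⟨b, hb⟩ := he.self_of_nhds
  rw [← hb, ← hb]
  exact orthonormal_iff_ite.1 b.orthonormal i j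

theorem contMDiff_mlieBracket (X Y : SmoothField E M) :
    CMDiff ∞ (T% (mlieBracket 𝓘(ℝ, E) X Y)) := by
  have : IsManifold 𝓘(ℝ, E) (((⊤ : ℕ∞) : WithTop ℕ∞) + 1) M := by
    change IsManifold 𝓘(ℝ, E) ∞ M; infer_instance
  have : IsManifold 𝓘(ℝ, E) (minSmoothness ℝ 2) M := by
    simp only [minSmoothness_of_isRCLikeNormedField]
    infer_instance
  exact ContDiff.mlieBracket_vectorField (n := ⊤) (m := ⊤) X.contMDiff Y.contMDiff (by simp)

/-- The Lie bracket of smooth vector fields. -/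
def lie (X Y : SmoothField E M) : SmoothField E M :=
  ⟨mlieBracket 𝓘(ℝ, E) X Y, contMDiff_mlieBracket X Y⟩

theorem lie_apply (X Y : SmoothField E M) (x : M) : lie X Y x = mlieBracket 𝓘(ℝ, E) X Y x := rfl

theorem lie_add_right (X Y Z : SmoothField E M) : lie X (Y + Z) = lie X Y + lie X Z := by
  ext x
  exact mlieBracket_add_right (mdiffAt_field Y x) (mdiffAt_field Z x)

theorem lie_swap (X Y : SmoothField E M) : lie X Y = -lie Y X := by
  ext x
  exact mlieBracket_swap_apply

theorem lie_add_left (X Y Z : SmoothField E M) : lie (X + Y) Z = lie X Z + lie Y Z := by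
  rw [lie_swap, lie_add_right, lie_swap Z X, lie_swap Z Y]
  abel

theorem lie_lie (X Y Z : SmoothField E M) :
    lie X (lie Y Z) = lie (lie X Y) Z + lie Y (lie X Z) := by
  have : IsManifold 𝓘(ℝ, E) (minSmoothness ℝ 3) M := by
    simp only [minSmoothness_of_isRCLikeNormedField]
    infer_instance
  have h2 : minSmoothness ℝ 2 ≤ ∞ := by
    simp only [minSmoothness_of_isRCLikeNormedField]
    exact WithTop.coe_le_coe.2 le_top
  ext x
  exact leibniz_identity_mlieBracket_apply ((X.contMDiff x).of_le h2) ((Y.contMDiff x).of_le h2)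
    ((Z.contMDiff x).of_le h2)

section Connection

variable [T2Space M] [RiemannianBundle (fun x : M ↦ TangentSpace 𝓘(ℝ, E) x)]
  [IsContMDiffRiemannianBundle 𝓘(ℝ, E) ∞ E (fun x : M ↦ TangentSpace 𝓘(ℝ, E) x)]

theorem contMDiff_mvfderiv (X : SmoothField E M) (f : SmoothFun E M) :
    CMDiff ∞ (fun x ↦ mvfderiv 𝓘(ℝ, E) f x (X x)) := by
  intro x
  rcases subsingleton_or_nontrivial E with hE | hE
  · have h0 : (fun x ↦ mvfderiv 𝓘(ℝ, E) f x (X x)) = fun _ ↦ (0 : ℝ) := by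
      funext y
      have : X y = 0 := Subsingleton.elim (α := E) _ _
      rw [this, map_zero]
    rw [h0]
    exact contMDiffAt_const
  · obtain ⟨v, hv⟩ := exists_ne (0 : E)
    obtain ⟨Z, hZ⟩ := exists_smoothField_apply_eq (x := x) (v : TangentSpace 𝓘(ℝ, E) x)
    have key (y : M) : (lie X (f • Z) - f • lie X Z) y =
        mvfderiv 𝓘(ℝ, E) f y (X y) • Z y := by
      have := mlieBracket_smul_right (V := (X : Π x : M, TangentSpace 𝓘(ℝ, E) x))
        (mdiffAt_fun f y) (mdiffAt_field Z y)
      rw [sub_field_apply, lie_apply, coe_smul_field, this, smul_field_apply, lie_apply]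
      abel
    have hne : metric Z Z x ≠ 0 := by
      rw [metric_apply, hZ]
      exact inner_self_ne_zero.2 hv
    have hsm : CMDiffAt ∞
        (fun y ↦ metric (lie X (f • Z) - f • lie X Z) Z y / metric Z Z y) x :=
      ((metric _ _).contMDiff x).div₀ ((metric Z Z).contMDiff x) hne
    refine hsm.congr_of_eventuallyEq ?_
    filter_upwards [(metric Z Z).contMDiff.continuous.continuousAt.eventually_ne hne] with y hy
    rw [metric_apply, key, inner_smul_left, ← metric_apply]
    rw [mul_div_assoc, div_self hy, mul_one]
    rfl

/-- The derivative `X f` of a smooth function along a smooth vector field. -/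
def deriv (X : SmoothField E M) (f : SmoothFun E M) : SmoothFun E M :=
  ⟨fun x ↦ mvfderiv 𝓘(ℝ, E) f x (X x), contMDiff_mvfderiv X f⟩

theorem deriv_apply (X : SmoothField E M) (f : SmoothFun E M) (x : M) :
    deriv X f x = mvfderiv 𝓘(ℝ, E) f x (X x) := rfl

theorem deriv_add (X : SmoothField E M) (f h : SmoothFun E M) :
    deriv X (f + h) = deriv X f + deriv X h := by
  ext x
  have := mvfderiv_add (mdiffAt_fun f x) (mdiffAt_fun h x)
  simp only [deriv_apply, ContMDiffMap.coe_add, Pi.add_apply, this]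
  rfl

theorem deriv_mul (X : SmoothField E M) (f h : SmoothFun E M) :
    deriv X (f * h) = f * deriv X h + h * deriv X f := by
  ext x
  have := mvfderiv_mul (mdiffAt_fun f x) (mdiffAt_fun h x)
  simp only [deriv_apply, ContMDiffMap.coe_add, ContMDiffMap.coe_mul, Pi.add_apply, Pi.mul_apply,
    this]
  rfl

theorem algebraMap_fun_apply (c : ℝ) (x : M) : algebraMap ℝ (SmoothFun E M) c x = c := by
  simp [Algebra.algebraMap_eq_smul_one]

theorem deriv_const (X : SmoothField E M) (c : ℝ) :
    deriv X (algebraMap ℝ (SmoothFun E M) c) = 0 := by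
  ext x
  have : ⇑(algebraMap ℝ (SmoothFun E M) c) = fun _ : M ↦ c :=
    funext (algebraMap_fun_apply c)
  rw [deriv_apply, this, mvfderiv_const]
  rfl

theorem lie_smul_right (X : SmoothField E M) (f : SmoothFun E M) (Y : SmoothField E M) :
    lie X (f • Y) = deriv X f • Y + f • lie X Y := by
  ext x
  exact mlieBracket_smul_right (V := (X : Π x : M, TangentSpace 𝓘(ℝ, E) x))
    (mdiffAt_fun f x) (mdiffAt_field Y x)

theorem lie_smul_left (f : SmoothFun E M) (X Y : SmoothField E M) :
    lie (f • X) Y = f • lie X Y - deriv Y f • X := by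
  rw [lie_swap, lie_smul_right, lie_swap Y X]
  module

theorem deriv_lie (X Y : SmoothField E M) (f : SmoothFun E M) :
    deriv (lie X Y) f = deriv X (deriv Y f) - deriv Y (deriv X f) := by
  have key (Z : SmoothField E M) :
      (deriv (lie X Y) f - (deriv X (deriv Y f) - deriv Y (deriv X f))) • Z = 0 := by
    have h := lie_lie X Y (f • Z)
    simp only [lie_smul_right, lie_add_right, lie_lie X Y Z] at h
    linear_combination (norm := module) (-1 : SmoothFun E M) • h
  ext x
  rcases subsingleton_or_nontrivial E with hE | hE
  · have h0 (W : SmoothField E M) : W x = 0 := Subsingleton.elim (α := E) _ _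
    simp [deriv_apply, h0]
  · obtain ⟨v, hv⟩ := exists_ne (0 : E)
    obtain ⟨Z, hZ⟩ := exists_smoothField_apply_eq (x := x) (v : TangentSpace 𝓘(ℝ, E) x)
    have h := congrArg (fun W : SmoothField E M ↦ W x) (key Z)
    simp only [smul_field_apply, zero_field_apply, hZ] at h
    exact sub_eq_zero.1 ((smul_eq_zero.1 h).resolve_right hv)

theorem deriv_congr {X : SmoothField E M} {f h : SmoothFun E M} {x : M}
    (hfh : ∀ᶠ y in 𝓝 x, f y = h y) : deriv X f x = deriv X h x := by
  have := Filter.EventuallyEq.mfderiv_eq (I := 𝓘(ℝ, E)) (I' := 𝓘(ℝ)) hfh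
  simp only [deriv_apply, mvfderiv]
  change NormedSpace.fromTangentSpace (f x) (mfderiv 𝓘(ℝ, E) 𝓘(ℝ) f x (X x)) =
    NormedSpace.fromTangentSpace (h x) (mfderiv 𝓘(ℝ, E) 𝓘(ℝ) h x (X x))
  rw [this]
  rfl

/-- A vector field is smooth if its inner products with all smooth vector fields are. -/
theorem contMDiff_field_of_inner {W : Π x : M, TangentSpace 𝓘(ℝ, E) x}
    (h : ∀ Z : SmoothField E M, CMDiff ∞ (fun x ↦ (inner ℝ (W x) (Z x) : ℝ))) :
    CMDiff ∞ (T% W) := by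
  intro x
  obtain ⟨e, he⟩ := exists_isOrthonormalFrameAt (E := E) x
  have hs : CMDiffAt ∞ (T% (fun y ↦ ∑ i, ((fun y ↦ (inner ℝ (W y) (e i y) : ℝ)) •
      (e i : Π x : M, TangentSpace 𝓘(ℝ, E) x)) y)) x :=
    ContMDiffAt.sum_section fun i _ ↦ ((h (e i)) x).smul_section ((e i).contMDiff x)
  refine hs.congr_of_eventuallyEq ?_
  filter_upwards [he.eventually_nhds] with y hy
  have := hy.sum_inner_smul (W y)
  simp only [Pi.smul_apply', this]

theorem metric_comm (X Y : SmoothField E M) : metric X Y = metric Y X := by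
  ext x
  exact real_inner_comm (Y x) (X x)

theorem metric_add_left (X Y Z : SmoothField E M) :
    metric (X + Y) Z = metric X Z + metric Y Z := by
  ext x
  simp [inner_add_left]

theorem metric_smul_left (f : SmoothFun E M) (X Y : SmoothField E M) :
    metric (f • X) Y = f * metric X Y := by
  ext x
  simp [inner_smul_left]

theorem field_ext_metric {X Y : SmoothField E M} (h : ∀ Z, metric X Z = metric Y Z) : X = Y := by
  ext x
  refine ext_inner_right ℝ fun w ↦ ?_
  obtain ⟨Z, rfl⟩ := exists_smoothField_apply_eq w
  exact congrArg (fun f : SmoothFun E M ↦ f x) (h Z)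

theorem contMDiff_nabla (X Y : SmoothField E M) : CMDiff ∞ (T% (nabla 𝓘(ℝ, E) X Y)) := by
  refine contMDiff_field_of_inner fun Z ↦ ?_
  have : (fun x ↦ (inner ℝ (nabla 𝓘(ℝ, E) X Y x) (Z x) : ℝ)) =
      ((1 / 2 : ℝ) • (deriv X (metric Y Z) + deriv Y (metric Z X) - deriv Z (metric X Y)
        + metric (lie X Y) Z - metric (lie X Z) Y - metric (lie Y Z) X) : SmoothFun E M) := by
    funext x
    exact inner_leviCivita (mdiffAt_field X x) (mdiffAt_field Y x) (mdiffAt_field Z x)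
  rw [this]
  exact ContMDiffMap.contMDiff _

/-- The Levi-Civita connection on smooth vector fields. -/
def conn (X Y : SmoothField E M) : SmoothField E M :=
  ⟨nabla 𝓘(ℝ, E) X Y, contMDiff_nabla X Y⟩

theorem coe_conn (X Y : SmoothField E M) : ⇑(conn X Y) = nabla 𝓘(ℝ, E) X Y := rfl

theorem conn_apply (X Y : SmoothField E M) (x : M) : conn X Y x = leviCivita 𝓘(ℝ, E) M Y x (X x) :=
  rfl

theorem conn_add_left (X Y Z : SmoothField E M) : conn (X + Y) Z = conn X Z + conn Y Z := by
  ext x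
  simp [conn_apply]

theorem conn_smul_left (f : SmoothFun E M) (X Y : SmoothField E M) :
    conn (f • X) Y = f • conn X Y := by
  ext x
  simp [conn_apply]

theorem conn_add_right (X Y Z : SmoothField E M) : conn X (Y + Z) = conn X Y + conn X Z := by
  ext x
  have := (leviCivita 𝓘(ℝ, E) M).isCovariantDerivativeOnUniv.add (mdiffAt_field Y x)
    (mdiffAt_field Z x)
  exact congrArg (fun T ↦ T (X x)) this

theorem conn_smul_right (X : SmoothField E M) (f : SmoothFun E M) (Y : SmoothField E M) :
    conn X (f • Y) = f • conn X Y + deriv X f • Y := by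
  ext x
  have := (leviCivita 𝓘(ℝ, E) M).isCovariantDerivativeOnUniv.leibniz (mdiffAt_field Y x)
    (mdiffAt_fun f x)
  exact congrArg (fun T ↦ T (X x)) this

theorem conn_sub_conn (X Y : SmoothField E M) : conn X Y - conn Y X = lie X Y := by
  ext x
  exact (leviCivita 𝓘(ℝ, E) M).torsion_eq_zero_iff.1 leviCivita_torsion_eq_zero
    (mdiffAt_field X x) (mdiffAt_field Y x)

theorem deriv_metric (X Y Z : SmoothField E M) :
    deriv X (metric Y Z) = metric (conn X Y) Z + metric Y (conn X Z) := by
  ext x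
  exact leviCivita_metric (mdiffAt_field X x) (mdiffAt_field Y x) (mdiffAt_field Z x)


theorem lie_sub_right (X Y Z : SmoothField E M) : lie X (Y - Z) = lie X Y - lie X Z :=
  eq_sub_of_add_eq (by rw [← lie_add_right, sub_add_cancel])

theorem deriv_sub (X : SmoothField E M) (f h : SmoothFun E M) :
    deriv X (f - h) = deriv X f - deriv X h :=
  eq_sub_of_add_eq (by rw [← deriv_add, sub_add_cancel])

theorem deriv_zero (X : SmoothField E M) : deriv X (0 : SmoothFun E M) = 0 := by
  simpa using deriv_const X 0

theorem deriv_sum {ι : Type*} (s : Finset ι) (X : SmoothField E M) (f : ι → SmoothFun E M) :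
    deriv X (∑ i ∈ s, f i) = ∑ i ∈ s, deriv X (f i) := by
  classical
  induction s using Finset.induction_on with
  | empty => simp [deriv_zero]
  | insert a s ha h => simp [Finset.sum_insert ha, deriv_add, h]

theorem conn_sub_left (X Y Z : SmoothField E M) : conn (X - Y) Z = conn X Z - conn Y Z :=
  eq_sub_of_add_eq (by rw [← conn_add_left, sub_add_cancel])

theorem conn_sub_right (X Y Z : SmoothField E M) : conn X (Y - Z) = conn X Y - conn X Z :=
  eq_sub_of_add_eq (by rw [← conn_add_right, sub_add_cancel])

theorem conn_const_smul (X : SmoothField E M) (c : ℝ) (Y : SmoothField E M) :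
    conn X (algebraMap ℝ (SmoothFun E M) c • Y) = algebraMap ℝ (SmoothFun E M) c • conn X Y := by
  rw [conn_smul_right, deriv_const, zero_smul, add_zero]

theorem metric_sub_left (X Y Z : SmoothField E M) :
    metric (X - Y) Z = metric X Z - metric Y Z :=
  eq_sub_of_add_eq (by rw [← metric_add_left, sub_add_cancel])

theorem metric_add_right (X Y Z : SmoothField E M) :
    metric X (Y + Z) = metric X Y + metric X Z := by
  rw [metric_comm, metric_add_left, metric_comm Y, metric_comm Z]

theorem metric_sub_right (X Y Z : SmoothField E M) :
    metric X (Y - Z) = metric X Y - metric X Z := by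
  rw [metric_comm, metric_sub_left, metric_comm Y, metric_comm Z]

theorem metric_smul_right (f : SmoothFun E M) (X Y : SmoothField E M) :
    metric X (f • Y) = f * metric X Y := by
  rw [metric_comm, metric_smul_left, metric_comm Y]

/-- The curvature tensor on smooth vector fields. -/
def curv (X Y Z : SmoothField E M) : SmoothField E M :=
  conn X (conn Y Z) - conn Y (conn X Z) - conn (lie X Y) Z

theorem curv_smul_left (f : SmoothFun E M) (X Y Z : SmoothField E M) :
    curv (f • X) Y Z = f • curv X Y Z := by
  simp only [curv, conn_smul_left, conn_smul_right, lie_smul_left, conn_sub_left]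
  module

theorem curv_add_left (X X' Y Z : SmoothField E M) :
    curv (X + X') Y Z = curv X Y Z + curv X' Y Z := by
  simp only [curv, conn_add_left, conn_add_right, lie_add_left]
  abel

theorem curv_smul_right (f : SmoothFun E M) (X Y Z : SmoothField E M) :
    curv X Y (f • Z) = f • curv X Y Z := by
  simp only [curv, conn_smul_right, conn_add_right, deriv_lie]
  module

theorem curv_add_right (X Y Z Z' : SmoothField E M) :
    curv X Y (Z + Z') = curv X Y Z + curv X Y Z' := by
  simp only [curv, conn_add_right]
  abel

/-- The endomorphism `X ↦ R(X,Y)Z`. -/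
def curvEnd (Y Z : SmoothField E M) : SmoothField E M →ₗ[SmoothFun E M] SmoothField E M where
  toFun X := curv X Y Z
  map_add' X X' := curv_add_left X X' Y Z
  map_smul' f X := curv_smul_left f X Y Z

@[simp] theorem curvEnd_apply (X Y Z : SmoothField E M) : curvEnd Y Z X = curv X Y Z := rfl

theorem eventually_nabla_eq {X Y : Π x : M, TangentSpace 𝓘(ℝ, E) x} {X' Y' : SmoothField E M}
    {x : M} (hX : ∀ᶠ y in 𝓝 x, X' y = X y) (hY : ∀ᶠ y in 𝓝 x, Y' y = Y y) :
    ∀ᶠ y in 𝓝 x, conn X' Y' y = nabla 𝓘(ℝ, E) X Y y := by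
  filter_upwards [hX, eventually_eventually_nhds.2 hY] with y hXy hYy
  have hd : MDiffAt (T% Y) y := (mdiffAt_field Y' y).congr_of_eventuallyEq
    (by filter_upwards [hYy] with z hz; rw [hz])
  rw [conn_apply, nabla, hXy,
    (leviCivita 𝓘(ℝ, E) M).isCovariantDerivativeOnUniv.congr_of_eventuallyEq
      (mdiffAt_field Y' y) hd Filter.univ_mem hYy]

/-- The curvature only depends on the germs of its arguments. -/
theorem curv_apply_eq_curvature {X Y Z : Π x : M, TangentSpace 𝓘(ℝ, E) x}
    {X' Y' Z' : SmoothField E M} {x : M} (hX : ∀ᶠ y in 𝓝 x, X' y = X y)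
    (hY : ∀ᶠ y in 𝓝 x, Y' y = Y y) (hZ : ∀ᶠ y in 𝓝 x, Z' y = Z y) :
    curv X' Y' Z' x = curvature 𝓘(ℝ, E) X Y Z x := by
  have hlie : ∀ᶠ y in 𝓝 x, lie X' Y' y = mlieBracket 𝓘(ℝ, E) X Y y :=
    Filter.EventuallyEq.mlieBracket_vectorField hX hY
  simp only [curv, curvature, sub_field_apply, Pi.sub_apply,
    (eventually_nabla_eq hX (eventually_nabla_eq hY hZ)).self_of_nhds,
    (eventually_nabla_eq hY (eventually_nabla_eq hX hZ)).self_of_nhds,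
    (eventually_nabla_eq hlie hZ).self_of_nhds]

section Frame

variable {ι : Type*} [Fintype ι] {e : ι → SmoothField E M} {x : M}

theorem linearMap_apply_eq_zero_of_eventually (α : SmoothField E M →ₗ[SmoothFun E M] SmoothFun E M)
    {X : SmoothField E M} (h : ∀ᶠ y in 𝓝 x, X y = 0) : α X x = 0 := by
  obtain ⟨ψ, hψ, hs⟩ := exists_smoothFun_eventuallyEq_one (E := E) h
  have h0 : ψ • X = 0 := by
    ext y
    by_cases hy : y ∈ tsupport ψ
    · have : X y = 0 := hs hy
      simp [this]
    · simp [image_eq_zero_of_notMem_tsupport hy]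
  have := congrArg (fun f : SmoothFun E M ↦ f x) (α.map_smul ψ X)
  simpa [h0, hψ.self_of_nhds] using this.symm

/-- The pointwise expansion of a linear functional on vector fields along an orthonormal frame. -/
theorem IsOrthonormalFrameAt.functional_apply (he : IsOrthonormalFrameAt e x)
    (α : SmoothField E M →ₗ[SmoothFun E M] SmoothFun E M) (X : SmoothField E M) :
    α X x = ∑ i, (inner ℝ (X x) (e i x) : ℝ) * α (e i) x := by
  have h : α (X - ∑ i, metric X (e i) • e i) x = 0 := by
    refine linearMap_apply_eq_zero_of_eventually α ?_
    filter_upwards [he.eventually_nhds] with y hy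
    simp [hy.sum_inner_smul (X y)]
  rw [map_sub, map_sum] at h
  simpa [sub_eq_zero] using h

theorem functional_apply_congr (α : SmoothField E M →ₗ[SmoothFun E M] SmoothFun E M)
    {X Y : SmoothField E M} (h : X x = Y x) : α X x = α Y x := by
  obtain ⟨e, he⟩ := exists_isOrthonormalFrameAt (E := E) x
  rw [he.functional_apply, he.functional_apply α Y, h]

/-- The functional `X ↦ g(AX, Z)`. -/
def metricComp (A : SmoothField E M →ₗ[SmoothFun E M] SmoothField E M) (Z : SmoothField E M) :
    SmoothField E M →ₗ[SmoothFun E M] SmoothFun E M where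
  toFun X := metric (A X) Z
  map_add' X Y := by rw [map_add, metric_add_left]
  map_smul' f X := by rw [map_smul, metric_smul_left]; rfl

@[simp] theorem metricComp_apply (A : SmoothField E M →ₗ[SmoothFun E M] SmoothField E M)
    (X Z : SmoothField E M) : metricComp A Z X = metric (A X) Z := rfl

theorem IsOrthonormalFrameAt.endomorphism_apply (he : IsOrthonormalFrameAt e x)
    (A : SmoothField E M →ₗ[SmoothFun E M] SmoothField E M) (X : SmoothField E M) :
    A X x = ∑ i, (inner ℝ (X x) (e i x) : ℝ) • A (e i) x := by
  refine ext_inner_right ℝ fun w ↦ ?_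
  obtain ⟨Z, rfl⟩ := exists_smoothField_apply_eq w
  simpa [sum_inner, inner_smul_left] using he.functional_apply (metricComp A Z) X

/-- The trace of an endomorphism of vector fields with respect to a frame. -/
def frameTrace (e : ι → SmoothField E M)
    (A : SmoothField E M →ₗ[SmoothFun E M] SmoothField E M) : SmoothFun E M :=
  ∑ i, metric (A (e i)) (e i)

theorem frameTrace_apply (A : SmoothField E M →ₗ[SmoothFun E M] SmoothField E M) :
    frameTrace e A x = ∑ i, inner ℝ (A (e i) x) (e i x) := by
  simp [frameTrace]

theorem IsOrthonormalFrameAt.frameTrace_comp_comm (he : IsOrthonormalFrameAt e x)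
    (A B : SmoothField E M →ₗ[SmoothFun E M] SmoothField E M) :
    frameTrace e (A ∘ₗ B) x = frameTrace e (B ∘ₗ A) x := by
  simp only [frameTrace_apply, LinearMap.comp_apply]
  have h (A B : SmoothField E M →ₗ[SmoothFun E M] SmoothField E M) (i : ι) :
      (inner ℝ (A (B (e i)) x) (e i x) : ℝ) =
        ∑ j, (inner ℝ (B (e i) x) (e j x) : ℝ) * inner ℝ (A (e j) x) (e i x) := by
    rw [he.endomorphism_apply A]
    simp [sum_inner, inner_smul_left]
  simp only [h]
  rw [Finset.sum_comm]
  simp only [mul_comm]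

/-- The covariant differential `X ↦ ∇_X V`. -/
def connEnd (V : SmoothField E M) : SmoothField E M →ₗ[SmoothFun E M] SmoothField E M where
  toFun X := conn X V
  map_add' X Y := conn_add_left X Y V
  map_smul' f X := conn_smul_left f X V

@[simp] theorem connEnd_apply (X V : SmoothField E M) : connEnd V X = conn X V := rfl

/-- The trace commutes with the Lie derivative. -/
theorem IsOrthonormalFrameAt.deriv_frameTrace (he : IsOrthonormalFrameAt e x)
    (V : SmoothField E M) (A : SmoothField E M →ₗ[SmoothFun E M] SmoothField E M) :
    deriv V (frameTrace e A) x =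
      ∑ i, inner ℝ ((lie V (A (e i)) - A (lie V (e i))) x) (e i x) := by
  classical
  have hskew (i j : ι) : (inner ℝ (conn V (e i) x) (e j x) : ℝ) =
      -inner ℝ (conn V (e j) x) (e i x) := by
    have h0 : deriv V (metric (e i) (e j)) x = 0 := by
      rw [deriv_congr (h := algebraMap ℝ (SmoothFun E M) (if i = j then 1 else 0)), deriv_const]
      · rfl
      · filter_upwards [he.eventually_nhds] with y hy
        rw [metric_apply, hy.inner_eq, algebraMap_fun_apply]
    rw [deriv_metric] at h0
    have h1 : (inner ℝ (conn V (e i) x) (e j x) : ℝ) + inner ℝ (e i x) (conn V (e j) x) = 0 := h0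
    rw [real_inner_comm (e i x) (conn V (e j) x)]
    linarith
  have hcomm := he.frameTrace_comp_comm A (connEnd V)
  simp only [frameTrace_apply, LinearMap.comp_apply, connEnd_apply] at hcomm
  have h1 (i : ι) : (inner ℝ (A (conn V (e i)) x) (e i x) : ℝ) =
      ∑ j, (inner ℝ (conn V (e i) x) (e j x) : ℝ) * inner ℝ (A (e j) x) (e i x) := by
    rw [he.endomorphism_apply A]
    simp [sum_inner, inner_smul_left]
  have h2 (i : ι) : (inner ℝ (A (e i) x) (conn V (e i) x) : ℝ) =
      ∑ j, (inner ℝ (conn V (e i) x) (e j x) : ℝ) * inner ℝ (A (e i) x) (e j x) := by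
    rw [real_inner_comm, he.sum_inner_mul_inner (conn V (e i) x) (A (e i) x)]
  have hzero : ∑ i, ((inner ℝ (A (conn V (e i)) x) (e i x) : ℝ)
      + inner ℝ (A (e i) x) (conn V (e i) x)) = 0 := by
    simp only [h1, h2, Finset.sum_add_distrib]
    rw [Finset.sum_comm, ← Finset.sum_add_distrib]
    refine Finset.sum_eq_zero fun i _ ↦ ?_
    rw [← Finset.sum_add_distrib]
    refine Finset.sum_eq_zero fun j _ ↦ ?_
    rw [hskew i j]
    ring
  have hL (i : ι) : (inner ℝ ((lie V (A (e i)) - A (lie V (e i))) x) (e i x) : ℝ) =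
      inner ℝ (conn V (A (e i)) x) (e i x) - inner ℝ (conn (A (e i)) V x) (e i x)
        - inner ℝ (A (conn V (e i)) x) (e i x) + inner ℝ (A (conn (e i) V) x) (e i x) := by
    rw [← conn_sub_conn, ← conn_sub_conn, map_sub]
    simp only [sub_field_apply, inner_sub_left]
    ring
  simp only [hL, frameTrace, deriv_sum, sum_fun_apply, deriv_metric]
  simp only [ContMDiffMap.coe_add, Pi.add_apply, metric_apply, Finset.sum_add_distrib,
    Finset.sum_sub_distrib] at hzero ⊢
  linarith

theorem IsOrthonormalFrameAt.frameTrace_apply_eq {κ : Type*} [Fintype κ]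
    (he : IsOrthonormalFrameAt e x) (b : OrthonormalBasis κ ℝ (TangentSpace 𝓘(ℝ, E) x))
    (A : SmoothField E M →ₗ[SmoothFun E M] SmoothField E M) (X : κ → SmoothField E M)
    (hX : ∀ j, X j x = b j) : ∑ j, inner ℝ (A (X j) x) (b j) = frameTrace e A x := by
  have h (j : κ) : (inner ℝ (A (X j) x) (b j) : ℝ) =
      ∑ i, (inner ℝ (b j) (e i x) : ℝ) * inner ℝ (A (e i) x) (b j) := by
    rw [he.endomorphism_apply A, hX]
    simp [sum_inner, inner_smul_left]
  simp only [h]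
  rw [Finset.sum_comm, frameTrace_apply]
  refine Finset.sum_congr rfl fun i _ ↦ ?_
  rw [← b.sum_inner_mul_inner (A (e i) x) (e i x)]
  exact Finset.sum_congr rfl fun j _ ↦ mul_comm _ _

theorem IsOrthonormalFrameAt.ricci_apply (he : IsOrthonormalFrameAt e x)
    (Y : SmoothField E M) {Z : Π x : M, TangentSpace 𝓘(ℝ, E) x} {Z' : SmoothField E M}
    (hZ : ∀ᶠ y in 𝓝 x, Z' y = Z y) :
    ricci 𝓘(ℝ, E) Y Z x = frameTrace e (curvEnd Y Z') x := by
  choose X hX hX' using fun j ↦ exists_smoothField_eventuallyEq_extend (frame 𝓘(ℝ, E) x j)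
  rw [← he.frameTrace_apply_eq (frame 𝓘(ℝ, E) x) (curvEnd Y Z') X hX, ricci]
  refine Finset.sum_congr rfl fun j _ ↦ ?_
  rw [curvEnd_apply, curv_apply_eq_curvature (hX' j) (Filter.Eventually.of_forall fun _ ↦ rfl) hZ]

end Frame

theorem contMDiff_ricci (Y Z : SmoothField E M) : CMDiff ∞ (ricci 𝓘(ℝ, E) Y Z) := by
  intro x
  obtain ⟨e, he⟩ := exists_isOrthonormalFrameAt (E := E) x
  refine ((frameTrace e (curvEnd Y Z)).contMDiff x).congr_of_eventuallyEq ?_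
  filter_upwards [he.eventually_nhds] with y hy
  exact hy.ricci_apply Y (Filter.Eventually.of_forall fun _ ↦ rfl)

/-- The Ricci tensor on smooth vector fields. -/
def ric (Y Z : SmoothField E M) : SmoothFun E M := ⟨ricci 𝓘(ℝ, E) Y Z, contMDiff_ricci Y Z⟩

theorem ric_apply (Y Z : SmoothField E M) (x : M) : ric Y Z x = ricci 𝓘(ℝ, E) Y Z x := rfl

theorem IsOrthonormalFrameAt.ric_apply {ι : Type*} [Fintype ι] {e : ι → SmoothField E M} {x : M}
    (he : IsOrthonormalFrameAt e x) (Y Z : SmoothField E M) :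
    ric Y Z x = frameTrace e (curvEnd Y Z) x :=
  he.ricci_apply Y (Filter.Eventually.of_forall fun _ ↦ rfl)

theorem ric_add_right (Y Z Z' : SmoothField E M) : ric Y (Z + Z') = ric Y Z + ric Y Z' := by
  ext x
  obtain ⟨e, he⟩ := exists_isOrthonormalFrameAt (E := E) x
  simp [he.ric_apply, frameTrace_apply, curv_add_right, inner_add_left, Finset.sum_add_distrib]

theorem ric_smul_right (f : SmoothFun E M) (Y Z : SmoothField E M) :
    ric Y (f • Z) = f * ric Y Z := by
  ext x
  obtain ⟨e, he⟩ := exists_isOrthonormalFrameAt (E := E) x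
  simp [he.ric_apply, frameTrace_apply, curv_smul_right, inner_smul_left, Finset.mul_sum]

/-- The functional `Z ↦ S(Y,Z)`. -/
def ricFunctional (Y : SmoothField E M) : SmoothField E M →ₗ[SmoothFun E M] SmoothFun E M where
  toFun Z := ric Y Z
  map_add' Z Z' := ric_add_right Y Z Z'
  map_smul' f Z := ric_smul_right f Y Z

theorem inner_ricciOp (Y Z : SmoothField E M) (x : M) :
    inner ℝ (ricciOp 𝓘(ℝ, E) Y x) (Z x) = ric Y Z x := by
  obtain ⟨e, he⟩ := exists_isOrthonormalFrameAt (E := E) x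
  choose X hX hX' using fun j ↦ exists_smoothField_eventuallyEq_extend (frame 𝓘(ℝ, E) x j)
  have h (j) : ricci 𝓘(ℝ, E) Y (extend E (frame 𝓘(ℝ, E) x j)) x = ric Y (X j) x := by
    rw [he.ricci_apply Y (hX' j), he.ric_apply]
  have hZ : Z x = (∑ j, metric (X j) Z • X j) x := by
    simpa [hX] using ((frame 𝓘(ℝ, E) x).sum_repr' (Z x)).symm
  have h2 : ric Y Z x = ∑ j, (metric (X j) Z • ricFunctional Y (X j)) x := by
    have := functional_apply_congr (ricFunctional Y) hZ
    rw [map_sum, sum_fun_apply] at this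
    simp only [map_smul] at this
    exact this
  rw [h2, ricciOp, sum_inner]
  refine Finset.sum_congr rfl fun j _ ↦ ?_
  rw [h, inner_smul_left, ← hX j]
  exact mul_comm _ _

/-- The Ricci operator on smooth vector fields. -/
def ricOp (Y : SmoothField E M) : SmoothField E M :=
  ⟨ricciOp 𝓘(ℝ, E) Y, contMDiff_field_of_inner fun Z ↦ by
    simp only [inner_ricciOp]
    exact (ric Y Z).contMDiff⟩

theorem metric_ricOp (Y Z : SmoothField E M) : metric (ricOp Y) Z = ric Y Z := by
  ext x
  exact inner_ricciOp Y Z x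

/-- The Lie derivative of the Levi-Civita connection. -/
def lieConn (V X Y : SmoothField E M) : SmoothField E M :=
  lie V (conn X Y) - conn (lie V X) Y - conn X (lie V Y)

/-- The Lie derivative of the curvature tensor on smooth vector fields. -/
def lieCurv (V X Y Z : SmoothField E M) : SmoothField E M :=
  lie V (curv X Y Z) - curv (lie V X) Y Z - curv X (lie V Y) Z - curv X Y (lie V Z)

/-- The Lie derivative of the metric on smooth vector fields. -/
def lieMet (V X Y : SmoothField E M) : SmoothFun E M :=
  deriv V (metric X Y) - metric (lie V X) Y - metric X (lie V Y)

theorem lieCurv_eq (V X Y Z : SmoothField E M) :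
    lieCurv V X Y Z = conn X (lieConn V Y Z) + lieConn V X (conn Y Z)
      - conn Y (lieConn V X Z) - lieConn V Y (conn X Z) - lieConn V (lie X Y) Z := by
  simp only [lieCurv, curv, lieConn, lie_sub_right, conn_sub_right, lie_lie V X Y, conn_add_left]
  abel

theorem lieConn_symm (V X Y : SmoothField E M) : lieConn V X Y = lieConn V Y X := by
  have h := lie_lie V X Y
  rw [← conn_sub_conn X Y, ← conn_sub_conn (lie V X) Y, ← conn_sub_conn X (lie V Y),
    lie_sub_right] at h
  simp only [lieConn]
  linear_combination (norm := module) (1 : SmoothFun E M) • h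

theorem lieConn_smul_left (f : SmoothFun E M) (V X Y : SmoothField E M) :
    lieConn V (f • X) Y = f • lieConn V X Y := by
  simp only [lieConn, conn_smul_left, lie_smul_right, conn_add_left]
  module

theorem lieConn_sub_left (V X X' Y : SmoothField E M) :
    lieConn V (X - X') Y = lieConn V X Y - lieConn V X' Y := by
  simp only [lieConn, conn_sub_left, lie_sub_right]
  abel

/-- The covariant derivative of `L_V g`, in terms of `L_V ∇`. -/
theorem metric_lieConn_add (V X Y Z : SmoothField E M) :
    metric (lieConn V X Y) Z + metric Y (lieConn V X Z) =
      deriv X (lieMet V Y Z) - lieMet V (conn X Y) Z - lieMet V Y (conn X Z) := by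
  have h := deriv_lie V X (metric Y Z)
  simp only [lieMet, lieConn, metric_sub_left, metric_sub_right, deriv_sub]
  simp only [deriv_metric, deriv_add] at h ⊢
  linear_combination -h

theorem two_mul_metric_lieConn (V X Y Z : SmoothField E M) :
    2 * metric (lieConn V X Y) Z =
      (deriv X (lieMet V Y Z) - lieMet V (conn X Y) Z - lieMet V Y (conn X Z))
      + (deriv Y (lieMet V X Z) - lieMet V (conn Y X) Z - lieMet V X (conn Y Z))
      - (deriv Z (lieMet V X Y) - lieMet V (conn Z X) Y - lieMet V X (conn Z Y)) := by
  rw [← metric_lieConn_add, ← metric_lieConn_add, ← metric_lieConn_add, lieConn_symm V Y X,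
    lieConn_symm V Z X, lieConn_symm V Z Y, metric_comm X, metric_comm Y]
  ring

theorem field_ext_two_mul_metric {X Y : SmoothField E M}
    (h : ∀ Z, 2 * metric X Z = 2 * metric Y Z) : X = Y := by
  refine field_ext_metric fun Z ↦ ?_
  ext x
  have := congrArg (fun f : SmoothFun E M ↦ f x) (h Z)
  simp only [two_mul, ContMDiffMap.coe_add, Pi.add_apply] at this
  linarith

section Kenmotsu

variable {ξ : SmoothField E M}

theorem deriv_metric_xi (hξ : ∀ X, conn X ξ = X - metric X ξ • ξ)
    (X Y : SmoothField E M) :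
    deriv X (metric Y ξ) = metric (conn X Y) ξ + metric X Y - metric X ξ * metric Y ξ := by
  rw [deriv_metric, hξ, metric_sub_right, metric_smul_right, metric_comm Y X]
  ring

theorem lie_xi (hξ : ∀ X, conn X ξ = X - metric X ξ • ξ)
    (X : SmoothField E M) : lie ξ X = conn ξ X - X + metric X ξ • ξ := by
  rw [← conn_sub_conn, hξ]
  abel

theorem curv_xi (hξ : ∀ X, conn X ξ = X - metric X ξ • ξ)
    (X Y : SmoothField E M) :
    curv X Y ξ = metric X ξ • Y - metric Y ξ • X := by
  simp only [curv, hξ, conn_sub_right, conn_smul_right, deriv_metric_xi hξ]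
  simp only [← conn_sub_conn X Y, metric_sub_left, metric_comm Y X]
  module

theorem lieMet_xi (hξ : ∀ X, conn X ξ = X - metric X ξ • ξ)
    (X Y : SmoothField E M) :
    lieMet ξ X Y = 2 * (metric X Y - metric X ξ * metric Y ξ) := by
  simp only [lieMet, lie_xi hξ, deriv_metric, metric_add_left, metric_sub_left, metric_smul_left,
    metric_add_right, metric_sub_right, metric_smul_right, metric_comm ξ Y]
  ring

theorem lieConn_xi (hξ : ∀ X, conn X ξ = X - metric X ξ • ξ)
    (X Y : SmoothField E M) :
    lieConn ξ X Y = (-2 * (metric X Y - metric X ξ * metric Y ξ)) • ξ := by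
  refine field_ext_two_mul_metric fun Z ↦ ?_
  have h2 (W : SmoothField E M) (f : SmoothFun E M) : deriv W (2 * f) = 2 * deriv W f := by
    rw [two_mul, deriv_add, two_mul]
  rw [two_mul_metric_lieConn]
  simp only [lieMet_xi hξ, h2, deriv_sub, deriv_mul, deriv_metric_xi hξ, metric_smul_left]
  simp only [deriv_metric, metric_comm ξ Z, metric_comm Y X, metric_comm Z X, metric_comm Z Y]
  ring

theorem lieCurv_xi (hξ : ∀ X, conn X ξ = X - metric X ξ • ξ)
    (X Y Z : SmoothField E M) :
    lieCurv ξ X Y Z = (2 * (metric X Z - metric X ξ * metric Z ξ)) • Y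
      - (2 * (metric Y Z - metric Y ξ * metric Z ξ)) • X := by
  have h2 (W : SmoothField E M) (f : SmoothFun E M) : deriv W (-2 * f) = -2 * deriv W f := by
    rw [show (-2 * f : SmoothFun E M) = 0 - f - f by ring, deriv_sub, deriv_sub, deriv_zero]
    ring
  rw [lieCurv_eq]
  simp only [lieConn_xi hξ, conn_smul_right, h2, deriv_sub, deriv_mul, deriv_metric_xi hξ, hξ]
  simp only [deriv_metric, ← conn_sub_conn X Y, metric_sub_left, metric_comm Y X]
  module

theorem ric_xi (hξ : ∀ X, conn X ξ = X - metric X ξ • ξ)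
    (Y : SmoothField E M) :
    ric Y ξ = algebraMap ℝ (SmoothFun E M) (1 - Module.finrank ℝ E) * metric Y ξ := by
  ext x
  obtain ⟨e, he⟩ := exists_isOrthonormalFrameAt (E := E) x
  rw [he.ric_apply, frameTrace_apply]
  have h1 := he.sum_inner_mul_inner (Y x) (ξ x)
  have h2 (i) : (inner ℝ (e i x) (e i x) : ℝ) = 1 := by rw [he.inner_eq, if_pos rfl]
  simp only [curvEnd_apply, curv_xi hξ, sub_field_apply, smul_field_apply, inner_sub_left,
    inner_smul_left, metric_apply, h2, Finset.sum_sub_distrib]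
  have h3 : ∑ i, (inner ℝ (e i x) (ξ x) : ℝ) * inner ℝ (Y x) (e i x) = inner ℝ (Y x) (ξ x) := by
    rw [← h1]
    exact Finset.sum_congr rfl fun i _ ↦ by rw [mul_comm, real_inner_comm (e i x) (ξ x)]
  rw [ContMDiffMap.coe_mul, Pi.mul_apply, algebraMap_fun_apply]
  simp only [conj_trivial, h3, Finset.sum_const, Finset.card_univ, Fintype.card_fin, nsmul_eq_mul,
    metric_apply]
  ring

theorem lie_ric_xi (hξ : ∀ X, conn X ξ = X - metric X ξ • ξ)
    (Y Z : SmoothField E M) :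
    deriv ξ (ric Y Z) - ric (lie ξ Y) Z - ric Y (lie ξ Z) =
      algebraMap ℝ (SmoothFun E M) (2 * (1 - Module.finrank ℝ E))
        * (metric Y Z - metric Y ξ * metric Z ξ) := by
  ext x
  obtain ⟨e, he⟩ := exists_isOrthonormalFrameAt (E := E) x
  have hd : deriv ξ (ric Y Z) x = deriv ξ (frameTrace e (curvEnd Y Z)) x :=
    deriv_congr (by filter_upwards [he.eventually_nhds] with y hy using hy.ric_apply Y Z)
  have hL (i) : (inner ℝ ((lie ξ (curv (e i) Y Z) - curv (lie ξ (e i)) Y Z) x) (e i x) : ℝ) =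
      inner ℝ (curv (e i) (lie ξ Y) Z x) (e i x) + inner ℝ (curv (e i) Y (lie ξ Z) x) (e i x)
      + 2 * ((inner ℝ (Z x) (e i x) : ℝ) * inner ℝ (Y x) (e i x)
        - inner ℝ (ξ x) (e i x) * inner ℝ (Y x) (e i x) * inner ℝ (Z x) (ξ x))
      - 2 * (inner ℝ (Y x) (Z x) - inner ℝ (Y x) (ξ x) * inner ℝ (Z x) (ξ x)) := by
    have h := lieCurv_xi hξ (e i) Y Z
    have h' : lie ξ (curv (e i) Y Z) - curv (lie ξ (e i)) Y Z =
        curv (e i) (lie ξ Y) Z + curv (e i) Y (lie ξ Z)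
        + (2 * (metric (e i) Z - metric (e i) ξ * metric Z ξ)) • Y
        - (2 * (metric Y Z - metric Y ξ * metric Z ξ)) • e i := by
      rw [add_sub_assoc, ← h, lieCurv]
      abel
    have h2 : (inner ℝ (e i x) (e i x) : ℝ) = 1 := by rw [he.inner_eq, if_pos rfl]
    rw [h']
    simp only [two_mul, sub_field_apply, add_field_apply, smul_field_apply, inner_sub_left,
      inner_add_left, inner_smul_left, h2, ContMDiffMap.coe_add, ContMDiffMap.coe_sub,
      ContMDiffMap.coe_mul, Pi.add_apply, Pi.sub_apply, Pi.mul_apply, metric_apply, conj_trivial]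
    rw [real_inner_comm (Z x) (e i x), real_inner_comm (ξ x) (e i x)]
    ring
  have hsum := he.deriv_frameTrace ξ (curvEnd Y Z)
  simp only [curvEnd_apply, hL, Finset.sum_add_distrib, Finset.sum_sub_distrib, ← Finset.mul_sum,
    ← Finset.sum_mul, he.sum_inner_mul_inner, Finset.sum_const, Finset.card_univ, Fintype.card_fin,
    nsmul_eq_mul] at hsum
  simp only [ContMDiffMap.coe_sub, ContMDiffMap.coe_mul, Pi.sub_apply, Pi.mul_apply,
    algebraMap_fun_apply, metric_apply]
  rw [hd, hsum, he.ric_apply, he.ric_apply, frameTrace_apply, frameTrace_apply]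
  simp only [curvEnd_apply]
  rw [real_inner_comm (Y x) (Z x), real_inner_comm (ξ x) (Y x)]
  ring

/-- The covariant derivative of the Ricci tensor of a Kenmotsu manifold along `ξ`. -/
theorem conn_xi_ric (hξ : ∀ X, conn X ξ = X - metric X ξ • ξ)
    (hS : ∀ Y Z : SmoothField E M, ric Y Z = ric Z Y) (Y Z : SmoothField E M) :
    deriv ξ (ric Y Z) - ric (conn ξ Y) Z - ric Y (conn ξ Z) =
      -2 * ric Y Z + algebraMap ℝ (SmoothFun E M) (2 * (1 - Module.finrank ℝ E)) * metric Y Z := by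
  have h := lie_ric_xi hξ Y Z
  have hr (Y : SmoothField E M) : conn ξ Y = lie ξ Y + Y + (-metric Y ξ) • ξ := by
    rw [lie_xi hξ]
    module
  rw [hr Y, hr Z, hS (lie ξ Y + Y + _) Z]
  simp only [ric_add_right, ric_smul_right, ric_xi hξ]
  rw [hS Z (lie ξ Y), hS Z Y]
  rw [map_mul, map_ofNat] at h ⊢
  linear_combination h

/-- The Ricci tensor is symmetric as soon as it is a combination of symmetric tensors. -/
theorem ric_symm_of_soliton {V : SmoothField E M} {a m : ℝ}
    (hV : ∀ X Y, lieMet V X Y + 2 * ric X Y + algebraMap ℝ (SmoothFun E M) a * metric X Y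
      + algebraMap ℝ (SmoothFun E M) m * (metric X ξ * metric Y ξ) = 0) (X Y : SmoothField E M) :
    ric X Y = ric Y X := by
  have h1 := hV X Y
  have h2 := hV Y X
  simp only [lieMet, metric_comm Y X, metric_comm Y (lie V X), metric_comm (lie V Y) X] at h1 h2
  have h : 2 * ric X Y = 2 * ric Y X := by linear_combination h1 - h2
  ext x
  have := congrArg (fun f : SmoothFun E M ↦ f x) h
  simp only [two_mul, ContMDiffMap.coe_add, Pi.add_apply] at this
  linarith

theorem ricOp_sub (hS : ∀ Y Z : SmoothField E M, ric Y Z = ric Z Y) (X Y : SmoothField E M) :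
    ricOp (X - Y) = ricOp X - ricOp Y := by
  refine field_ext_metric fun Z ↦ ?_
  have h := ric_add_right Z (X - Y) Y
  rw [sub_add_cancel] at h
  rw [metric_sub_left, metric_ricOp, metric_ricOp, metric_ricOp, hS X Z, hS Y Z, hS (X - Y) Z, h]
  ring

/-- The Lie derivative of the connection along the potential field, evaluated at `ξ`. -/
theorem lieConn_apply_xi (hξ : ∀ X, conn X ξ = X - metric X ξ • ξ)
    (hξξ : metric ξ ξ = 1) {V : SmoothField E M} {a m : ℝ}
    (hV : ∀ X Y, lieMet V X Y + 2 * ric X Y + algebraMap ℝ (SmoothFun E M) a * metric X Y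
      + algebraMap ℝ (SmoothFun E M) m * (metric X ξ * metric Y ξ) = 0) (X : SmoothField E M) :
    lieConn V X ξ = algebraMap ℝ (SmoothFun E M) 2 • ricOp X
      - algebraMap ℝ (SmoothFun E M) (2 * (1 - Module.finrank ℝ E)) • X := by
  have hS := ric_symm_of_soliton hV
  refine field_ext_two_mul_metric fun Z ↦ ?_
  have hL (X Y : SmoothField E M) : lieMet V X Y =
      0 - algebraMap ℝ (SmoothFun E M) 2 * ric X Y - algebraMap ℝ (SmoothFun E M) a * metric X Y
      - algebraMap ℝ (SmoothFun E M) m * (metric X ξ * metric Y ξ) := by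
    rw [map_ofNat]
    linear_combination hV X Y
  have hsub (X Y Z : SmoothField E M) : ric X (Y - Z) = ric X Y - ric X Z :=
    eq_sub_of_add_eq (by rw [← ric_add_right, sub_add_cancel])
  have hsubl (X Y Z : SmoothField E M) : ric (Y - Z) X = ric Y X - ric Z X := by
    rw [hS, hsub, hS X Y, hS X Z]
  have hsmull (f : SmoothFun E M) (X Y : SmoothField E M) : ric (f • X) Y = f * ric X Y := by
    rw [hS, ric_smul_right, hS Y X]
  have hξl (Y : SmoothField E M) : ric ξ Y =
      algebraMap ℝ (SmoothFun E M) (1 - Module.finrank ℝ E) * metric Y ξ := by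
    rw [hS, ric_xi hξ]
  have hN := conn_xi_ric hξ hS X Z
  rw [two_mul_metric_lieConn]
  simp only [hL, deriv_sub, deriv_const, deriv_zero, hξ, hsubl, hsub, hsmull, ric_smul_right,
    hξl, ric_xi hξ, metric_sub_left, metric_sub_right, metric_smul_left, metric_smul_right,
    metric_ricOp, deriv_mul, deriv_metric_xi hξ, metric_comm ξ]
  rw [deriv_metric]
  simp only [hξξ, metric_comm Z X, map_mul, map_ofNat] at hN ⊢
  linear_combination (-2) * hN

/-- The Lie derivative of the curvature along the potential field of a soliton. -/
theorem lieCurv_apply_xi (hξ : ∀ X, conn X ξ = X - metric X ξ • ξ)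
    (hξξ : metric ξ ξ = 1) {V : SmoothField E M} {a m : ℝ}
    (hV : ∀ X Y, lieMet V X Y + 2 * ric X Y + algebraMap ℝ (SmoothFun E M) a * metric X Y
      + algebraMap ℝ (SmoothFun E M) m * (metric X ξ * metric Y ξ) = 0) (X Y : SmoothField E M) :
    lieCurv V X Y ξ = algebraMap ℝ (SmoothFun E M) 2 •
        (conn X (ricOp Y) - ricOp (conn X Y) - (conn Y (ricOp X) - ricOp (conn Y X))
          + metric X ξ • ricOp Y - metric Y ξ • ricOp X)
      - algebraMap ℝ (SmoothFun E M) (2 * (1 - Module.finrank ℝ E)) •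
        (metric X ξ • Y - metric Y ξ • X) := by
  have hS := ric_symm_of_soliton hV
  have hR (Z W : SmoothField E M) : lieConn V Z (W - metric W ξ • ξ) =
      lieConn V W Z - metric W ξ • lieConn V Z ξ := by
    rw [lieConn_symm, lieConn_sub_left, lieConn_smul_left, lieConn_symm V ξ Z]
  rw [lieCurv_eq, hξ, hξ, hR, hR, lieConn_symm V Y X]
  simp only [lieConn_apply_xi hξ hξξ hV, conn_sub_right, conn_const_smul, ← conn_sub_conn X Y,
    ricOp_sub hS]
  module

end Kenmotsu

theorem IsKenmotsu.metric_xi_xi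
    {φ : Π x : M, TangentSpace 𝓘(ℝ, E) x →L[ℝ] TangentSpace 𝓘(ℝ, E) x}
    {ξ : SmoothField E M} {η : Π x : M, TangentSpace 𝓘(ℝ, E) x →L[ℝ] ℝ}
    (hK : IsKenmotsu 𝓘(ℝ, E) φ ξ η) : metric ξ ξ = 1 := by
  ext x
  rw [metric_apply, ← hK.eta_eq, hK.eta_xi]
  rfl

theorem IsKenmotsu.conn_xi {φ : Π x : M, TangentSpace 𝓘(ℝ, E) x →L[ℝ] TangentSpace 𝓘(ℝ, E) x}
    {ξ : SmoothField E M} {η : Π x : M, TangentSpace 𝓘(ℝ, E) x →L[ℝ] ℝ}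
    (hK : IsKenmotsu 𝓘(ℝ, E) φ ξ η) (X : SmoothField E M) :
    conn X ξ = X - metric X ξ • ξ := by
  have hφξ (x : M) : φ x (ξ x) = 0 := by
    have h := hK.inner_phi x (ξ x) (ξ x)
    rw [← hK.eta_eq, hK.eta_xi, mul_one, sub_self] at h
    exact inner_self_eq_zero.1 h
  have hξne (x : M) : ξ x ≠ 0 := fun h ↦ by
    have := hK.eta_xi x
    rw [h, map_zero] at this
    exact zero_ne_one this
  have hηφ (x : M) (u : TangentSpace 𝓘(ℝ, E) x) : η x (φ x u) = 0 := by
    have h1 := hK.phi_sq x (φ x u)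
    rw [hK.phi_sq x u, map_add, map_smul, hφξ, smul_zero, add_zero, map_neg, left_eq_add] at h1
    exact (smul_eq_zero.1 h1).resolve_right (hξne x)
  ext x
  have hη : η x (conn X ξ x) = 0 := by
    have h := deriv_metric X ξ ξ
    rw [hK.metric_xi_xi, ← map_one (algebraMap ℝ (SmoothFun E M)), deriv_const, metric_comm ξ] at h
    have h' : (0 : ℝ) = inner ℝ (conn X ξ x) (ξ x) + inner ℝ (conn X ξ x) (ξ x) :=
      congrArg (fun f : SmoothFun E M ↦ f x) h
    rw [hK.eta_eq]
    linarith
  have h := hK.nabla_phi X ξ X.contMDiff ξ.contMDiff x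
  have h0 : (fun y : M ↦ φ y (ξ y)) = 0 := funext hφξ
  have h1 : nabla 𝓘(ℝ, E) X (0 : Π x : M, TangentSpace 𝓘(ℝ, E) x) x = 0 := by
    simp [nabla]
  rw [h0, h1, ← coe_conn, hK.eta_xi, ← hK.eta_eq, hηφ, zero_smul, zero_sub, zero_sub, one_smul,
    neg_inj] at h
  have h2 := congrArg (φ x) h
  rw [hK.phi_sq, hK.phi_sq, hη, zero_smul, add_zero] at h2
  rw [sub_field_apply, smul_field_apply, metric_apply, ← hK.eta_eq, ← neg_inj, h2]
  abel

end Connection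

end

end RiemannGeom

theorem lie_derivative_curvature_xi_eq_of_conformal_eta_ricci_soliton
    {E : Type*} [NormedAddCommGroup E] [NormedSpace ℝ E] [FiniteDimensional ℝ E]
    {M : Type*} [TopologicalSpace M] [T2Space M] [ChartedSpace E M] [IsManifold 𝓘(ℝ, E) ∞ M]
    [RiemannianBundle (fun x : M ↦ TangentSpace 𝓘(ℝ, E) x)]
    [IsContMDiffRiemannianBundle 𝓘(ℝ, E) ∞ E (fun x : M ↦ TangentSpace 𝓘(ℝ, E) x)]
    (n : ℕ) (hdim : Module.finrank ℝ E = 2 * n + 1)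
    (φ : Π x : M, TangentSpace 𝓘(ℝ, E) x →L[ℝ] TangentSpace 𝓘(ℝ, E) x)
    (ξ : Π x : M, TangentSpace 𝓘(ℝ, E) x)
    (η : Π x : M, TangentSpace 𝓘(ℝ, E) x →L[ℝ] ℝ)
    (hK : RiemannGeom.IsKenmotsu 𝓘(ℝ, E) φ ξ η)
    (V : Π x : M, TangentSpace 𝓘(ℝ, E) x) (lam mu p : ℝ)
    (hV : RiemannGeom.IsConformalEtaRicciSoliton 𝓘(ℝ, E) η V lam mu p)
    (X Y : Π x : M, TangentSpace 𝓘(ℝ, E) x)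
    (hX : ContMDiff 𝓘(ℝ, E) 𝓘(ℝ, E).tangent ∞ (fun x ↦ (⟨x, X x⟩ : TangentBundle 𝓘(ℝ, E) M)))
    (hY : ContMDiff 𝓘(ℝ, E) 𝓘(ℝ, E).tangent ∞ (fun x ↦ (⟨x, Y x⟩ : TangentBundle 𝓘(ℝ, E) M)))
    (x : M) :
    RiemannGeom.lieCurvature 𝓘(ℝ, E) V X Y ξ x =
      (2 : ℝ) • (RiemannGeom.nablaRicciOp 𝓘(ℝ, E) X Y x
          - RiemannGeom.nablaRicciOp 𝓘(ℝ, E) Y X x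
          + η x (X x) • RiemannGeom.ricciOp 𝓘(ℝ, E) Y x
          - η x (Y x) • RiemannGeom.ricciOp 𝓘(ℝ, E) X x)
        + (4 * (n : ℝ)) • (η x (X x) • Y x - η x (Y x) • X x) := by
  let ξ' : RiemannGeom.SmoothField E M := ⟨ξ, hK.contMDiff_xi⟩
  let V' : RiemannGeom.SmoothField E M := ⟨V, hV.contMDiff_V⟩
  let X' : RiemannGeom.SmoothField E M := ⟨X, hX⟩
  let Y' : RiemannGeom.SmoothField E M := ⟨Y, hY⟩
  have hK' : RiemannGeom.IsKenmotsu 𝓘(ℝ, E) φ ξ' η := hK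
  have hsol (Z W : RiemannGeom.SmoothField E M) :
      RiemannGeom.lieMet V' Z W + 2 * RiemannGeom.ric Z W
        + algebraMap ℝ (RiemannGeom.SmoothFun E M)
          (2 * lam - (p + 2 / (Module.finrank ℝ E : ℝ))) * RiemannGeom.metric Z W
        + algebraMap ℝ (RiemannGeom.SmoothFun E M) (2 * mu)
          * (RiemannGeom.metric Z ξ' * RiemannGeom.metric W ξ') = 0 := by
    ext y
    have h := hV.soliton_eq Z W Z.contMDiff W.contMDiff y
    rw [hK.eta_eq, hK.eta_eq] at h
    rw [two_mul (RiemannGeom.ric Z W)]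
    simp only [ContMDiffMap.coe_add, ContMDiffMap.coe_mul, Pi.add_apply, Pi.mul_apply,
      RiemannGeom.algebraMap_fun_apply, RiemannGeom.metric_apply]
    rw [two_mul (RiemannGeom.ricci _ _ _ _)] at h
    exact h
  have h := congrArg (fun W : RiemannGeom.SmoothField E M ↦ W x)
    (RiemannGeom.lieCurv_apply_xi hK'.conn_xi hK'.metric_xi_xi hsol X' Y')
  simp only [RiemannGeom.sub_field_apply, RiemannGeom.add_field_apply,
    RiemannGeom.smul_field_apply, RiemannGeom.algebraMap_fun_apply, RiemannGeom.metric_apply,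
    hdim] at h
  rw [hK.eta_eq, hK.eta_eq]
  refine Eq.trans h ?_
  push_cast
  rw [sub_eq_add_neg _ ((_ : ℝ) • _), ← neg_smul,
    show -(2 * (1 - (2 * (n : ℝ) + 1))) = 4 * (n : ℝ) by ring]
  rfl
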